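/- Let μ > 4π. Define W'_μ := {(z₁,z₂,z₃) ∈ ℂ³ : z₂ ≠ 0, z₃ ≠ 0, |z₁ − exp(i·log|z₂z₃|²)| < 1, −μ < log|z₂|² < μ, −μ < log|z₃|² < μ} and Ŵ'_μ := W'_μ ∪ ⋃_{−μ/2 < a < μ/2 − 2π} {(z₁,z₂,z₃) ∈ ℂ³ : |z₁ − e^{2ia}| < 1, a < log|z₂|² < a + 2π, a < log|z₃|² < a + 2π}. Let (f_n) be a sequence of functions ℂ³ → ℂ such that each f_n is holomorphic on some open set Y_n containing the closure of W'_μ, let f be holomorphic and square-integrable on W'_μ, and assume ∫_{W'_μ} |f_n − f|² dV → 0 as n → ∞. Then there exists F : ℂ³ → ℂ holomorphic on Ŵ'_μ with F = f on W'_μ. -/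

import Mathlib

open Complex

/-- `log|z₂z₃|²` as a real number. -/
noncomputable def Lofz (z : ℂ × ℂ × ℂ) : ℝ :=
  Real.log (‖z.2.1 * z.2.2‖ ^ 2)

/-- The truncated worm `W'_μ`. -/
noncomputable def wormTrunc (μ : ℝ) : Set (ℂ × ℂ × ℂ) :=
  {z | z.2.1 ≠ 0 ∧ z.2.2 ≠ 0 ∧
    ‖z.1 - Complex.exp (Complex.I * (Lofz z : ℂ))‖ < 1 ∧
    -μ < Real.log (‖z.2.1‖ ^ 2) ∧ Real.log (‖z.2.1‖ ^ 2) < μ ∧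
    -μ < Real.log (‖z.2.2‖ ^ 2) ∧ Real.log (‖z.2.2‖ ^ 2) < μ}

/-- The enlargement `Ŵ'_μ` of `W'_μ`, obtained by attaching the sets
`Δ_a × 𝒜_a × 𝒜_a` for `a ∈ (−μ/2, μ/2 − 2π)`. -/
noncomputable def wormHat (μ : ℝ) : Set (ℂ × ℂ × ℂ) :=
  wormTrunc μ ∪
    ⋃ a ∈ Set.Ioo (-μ / 2) (μ / 2 - 2 * Real.pi),
      {z : ℂ × ℂ × ℂ |
        ‖z.1 - Complex.exp (2 * Complex.I * (a : ℂ))‖ < 1 ∧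
        z.2.1 ≠ 0 ∧ a < Real.log (‖z.2.1‖ ^ 2) ∧
          Real.log (‖z.2.1‖ ^ 2) < a + 2 * Real.pi ∧
        z.2.2 ≠ 0 ∧ a < Real.log (‖z.2.2‖ ^ 2) ∧
          Real.log (‖z.2.2‖ ^ 2) < a + 2 * Real.pi}



lemma continuousAt_fderiv_of_diffOn {E : Type*} [NormedAddCommGroup E] [NormedSpace ℂ E]
    [ProperSpace E] {G : E → ℂ} {O : Set E} (hO : IsOpen O) (hG : DifferentiableOn ℂ G O)
    {p : E} (hp : p ∈ O) : ContinuousAt (fderiv ℂ G) p := by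
  obtain ⟨r, hr, hrO⟩ := Metric.isOpen_iff.1 hO p hp
  have hsub : Metric.closedBall p (r/2) ⊆ O := fun x hx => hrO (by
    simp only [Metric.mem_closedBall, Metric.mem_ball] at *; linarith)
  have huc : UniformContinuousOn G (Metric.closedBall p (r/2)) :=
    (isCompact_closedBall p (r/2)).uniformContinuousOn_of_continuous (hG.continuousOn.mono hsub)
  rw [Metric.continuousAt_iff]
  intro ε hε
  rw [Metric.uniformContinuousOn_iff] at huc
  obtain ⟨δ, hδ, hd⟩ := huc (ε * (r/4) / 4) (by positivity)
  refine ⟨min δ (r/4), by positivity, fun q hq => ?_⟩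
  have hq1 : dist q p < δ := lt_of_lt_of_le hq (min_le_left _ _)
  have hq2 : dist q p < r/4 := lt_of_lt_of_le hq (min_le_right _ _)
  set g : E → ℂ := fun x => G (x + (q - p)) - G x with hg
  have hmem : ∀ x ∈ Metric.ball p (r/4), x ∈ Metric.closedBall p (r/2) ∧
      x + (q - p) ∈ Metric.closedBall p (r/2) := by
    intro x hx
    simp only [Metric.mem_ball, Metric.mem_closedBall] at *
    refine ⟨by linarith, ?_⟩
    have : dist (x + (q-p)) p ≤ dist x p + dist q p := by
      rw [dist_eq_norm, dist_eq_norm, dist_eq_norm]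
      calc _ = ‖(x - p) + (q - p)‖ := by congr 1; abel
        _ ≤ _ := norm_add_le _ _
    linarith
  have hdiff : DifferentiableOn ℂ g (Metric.ball p (r/4)) := by
    apply DifferentiableOn.sub
    · exact hG.comp (differentiableOn_id.add_const _) (fun x hx => hsub (hmem x hx).2)
    · exact hG.mono fun x hx => hsub (hmem x hx).1
  have hb : ∀ x ∈ Metric.ball p (r/4), ‖g x‖ < ε * (r/4) / 4 := by
    intro x hx
    have := hd (x + (q-p)) (hmem x hx).2 x (hmem x hx).1 (by
      rw [dist_eq_norm] at *; simpa using hq1)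
    rwa [dist_eq_norm] at this
  have hmaps : Set.MapsTo g (Metric.ball p (r/4)) (Metric.ball (g p) (ε * (r/4) / 2)) := by
    intro x hx
    rw [Metric.mem_ball, dist_eq_norm]
    have h1 := hb x hx
    have h2 := hb p (Metric.mem_ball_self (by positivity))
    calc _ ≤ ‖g x‖ + ‖g p‖ := norm_sub_le _ _
      _ < _ := by linarith
  have hle := Complex.norm_fderiv_le_div_of_mapsTo_ball hdiff
    (hmaps.mono_right Metric.ball_subset_closedBall) (by positivity)
  have hqO : q ∈ O := hrO (by rw [Metric.mem_ball]; linarith)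
  have hGq : HasFDerivAt G (fderiv ℂ G q) (p + (q - p)) := by
    rw [add_sub_cancel]
    exact (hG.differentiableAt (hO.mem_nhds hqO)).hasFDerivAt
  have hGp : HasFDerivAt G (fderiv ℂ G p) p :=
    (hG.differentiableAt (hO.mem_nhds hp)).hasFDerivAt
  have hgd : HasFDerivAt g (fderiv ℂ G q - fderiv ℂ G p) p :=
    ((hasFDerivAt_comp_add_right _).2 hGq).sub hGp
  rw [hgd.fderiv] at hle
  rw [dist_eq_norm]
  refine lt_of_le_of_lt hle ?_
  rw [div_lt_iff₀ (by positivity)]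
  nlinarith

lemma circleIntegral_differentiable {E : Type*} [NormedAddCommGroup E] [NormedSpace ℂ E]
    [ProperSpace E] {G : E × ℂ → ℂ} {O : Set (E × ℂ)} (hO : IsOpen O)
    (hG : DifferentiableOn ℂ G O) {ρ : ℝ} (hρ : 0 ≤ ρ) {z₀ : E}
    (hz : ∀ ζ ∈ Metric.sphere (0:ℂ) ρ, (z₀, ζ) ∈ O) :
    DifferentiableAt ℂ (fun z => ∮ ζ in C(0, ρ), G (z, ζ)) z₀ := by
  -- tube
  obtain ⟨u, v, hu, hv, hzu, hsv, huv⟩ := generalized_tube_lemma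
    (isCompact_singleton (x := z₀)) (isCompact_sphere (0:ℂ) ρ) hO (by
      rintro ⟨a, b⟩ ⟨ha, hb⟩
      simp only [Set.mem_singleton_iff] at ha
      subst ha; exact hz b hb)
  have hzu' : z₀ ∈ u := hzu rfl
  obtain ⟨r, hr, hru⟩ := Metric.isOpen_iff.1 hu z₀ hzu'
  have hsub : Metric.closedBall z₀ (r/2) ⊆ u := fun x hx => hru (by
    simp only [Metric.mem_closedBall, Metric.mem_ball] at *; linarith)
  set K : Set (E × ℂ) := Metric.closedBall z₀ (r/2) ×ˢ Metric.sphere (0:ℂ) ρ with hK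
  have hKc : IsCompact K := (isCompact_closedBall _ _).prod (isCompact_sphere _ _)
  have hKO : K ⊆ O := fun x hx => huv ⟨hsub hx.1, hsv hx.2⟩
  have hfc : ContinuousOn (fderiv ℂ G) O := fun x hx =>
    (continuousAt_fderiv_of_diffOn hO hG hx).continuousWithinAt
  obtain ⟨M, hM⟩ := hKc.exists_bound_of_continuousOn (hfc.mono hKO)
  have hmemO : ∀ x ∈ Metric.closedBall z₀ (r/2), ∀ t : ℝ, (x, circleMap 0 ρ t) ∈ K :=
    fun x hx t => ⟨hx, circleMap_mem_sphere 0 hρ t⟩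
  have hcont : ∀ x ∈ Metric.closedBall z₀ (r/2),
      Continuous (fun t : ℝ => deriv (circleMap 0 ρ) t • G (x, circleMap 0 ρ t)) := by
    intro x hx
    have h1 : Continuous (fun t : ℝ => G (x, circleMap 0 ρ t)) :=
      hG.continuousOn.comp_continuous (by fun_prop) (fun t => hKO (hmemO x hx t))
    have h2 : Continuous (deriv (circleMap 0 ρ)) := by
      have : deriv (circleMap 0 ρ) = fun t => circleMap 0 ρ t * I := by ext t; simp
      rw [this]; fun_prop
    exact h2.smul h1
  have hz0 : z₀ ∈ Metric.closedBall z₀ (r/2) := Metric.mem_closedBall_self (by positivity)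
  set F' : E → ℝ → E →L[ℂ] ℂ := fun x t =>
    deriv (circleMap 0 ρ) t • (fderiv ℂ G (x, circleMap 0 ρ t)).comp
      (ContinuousLinearMap.inl ℂ E ℂ) with hF'
  have key := intervalIntegral.hasFDerivAt_integral_of_dominated_of_fderiv_le (𝕜 := ℂ)
    (μ := MeasureTheory.volume) (a := 0) (b := 2 * Real.pi)
    (F := fun x t => deriv (circleMap 0 ρ) t • G (x, circleMap 0 ρ t)) (F' := F')
    (bound := fun _ => ρ * M) (x₀ := z₀) (s := Metric.closedBall z₀ (r/2))
    (Metric.closedBall_mem_nhds _ (by positivity)) ?_ ?_ ?_ ?_ ?_ ?_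
  · exact key.differentiableAt
  · filter_upwards [Metric.closedBall_mem_nhds z₀ (show 0 < r/2 by positivity)] with x hx
    exact (hcont x hx).aestronglyMeasurable
  · exact (hcont z₀ hz0).intervalIntegrable _ _
  · have h1 : Continuous (fun t : ℝ => fderiv ℂ G (z₀, circleMap 0 ρ t)) :=
      hfc.comp_continuous (by fun_prop) (fun t => hKO (hmemO z₀ hz0 t))
    have h2 : Continuous (deriv (circleMap 0 ρ)) := by
      have : deriv (circleMap 0 ρ) = fun t => circleMap 0 ρ t * I := by ext t; simp
      rw [this]; fun_prop
    have : Continuous (F' z₀) := by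
      apply h2.smul
      exact h1.clm_comp continuous_const
    exact this.aestronglyMeasurable
  · refine Filter.Eventually.of_forall fun t _ x hx => ?_
    rw [hF']
    simp only [norm_smul]
    have e1 : ‖deriv (circleMap 0 ρ) t‖ = ρ := by simp [abs_of_nonneg hρ]
    rw [e1]
    have e2 := hM _ (hmemO x hx t)
    have e3 := ContinuousLinearMap.opNorm_comp_le (fderiv ℂ G (x, circleMap 0 ρ t))
      (ContinuousLinearMap.inl ℂ E ℂ)
    have e4 : ‖ContinuousLinearMap.inl ℂ E ℂ‖ ≤ 1 := ContinuousLinearMap.norm_inl_le_one ℂ E ℂ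
    gcongr
    calc _ ≤ _ := e3
      _ ≤ ‖fderiv ℂ G (x, circleMap 0 ρ t)‖ * 1 := by gcongr
      _ ≤ M := by simpa using e2
  · exact intervalIntegrable_const
  · refine Filter.Eventually.of_forall fun t _ x hx => ?_
    have hd : HasFDerivAt G (fderiv ℂ G (x, circleMap 0 ρ t)) (x, circleMap 0 ρ t) :=
      (hG.differentiableAt (hO.mem_nhds (hKO (hmemO x hx t)))).hasFDerivAt
    have := HasFDerivAt.comp (f := fun e : E => (e, circleMap 0 ρ t)) x hd
      (hasFDerivAt_prodMk_left (𝕜 := ℂ) x (circleMap 0 ρ t))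
    exact this.const_smul (deriv (circleMap 0 ρ) t)

lemma cauchy_annulus {h : ℂ → ℂ} {r R : ℝ} (hr : 0 < r) (hrR : r < R) {U : Set ℂ} (hU : IsOpen U)
    (hsub : ∀ ζ : ℂ, r ≤ ‖ζ‖ → ‖ζ‖ ≤ R → ζ ∈ U) (hh : DifferentiableOn ℂ h U) {w : ℂ}
    (hw1 : r < ‖w‖) (hw2 : ‖w‖ < R) :
    (2 * Real.pi * I) * h w =
      (∮ ζ in C(0, R), (ζ - w)⁻¹ * h ζ) - ∮ ζ in C(0, r), (ζ - w)⁻¹ * h ζ := by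
  have hwU : w ∈ U := hsub w hw1.le hw2.le
  have hds : DifferentiableOn ℂ (dslope h w) U :=
    (Complex.differentiableOn_dslope (hU.mem_nhds hwU)).2 hh
  have hmem : ∀ z ∈ Metric.closedBall (0:ℂ) R \ Metric.ball 0 r, z ∈ U := by
    rintro z ⟨h1, h2⟩
    simp at h1 h2
    exact hsub z h2 h1
  have e := Complex.circleIntegral_eq_of_differentiable_on_annulus_off_countable (c := 0)
    hr hrR.le (s := ∅) Set.countable_empty (f := dslope h w)
    (hds.continuousOn.mono hmem) (by
      rintro z ⟨⟨h1, h2⟩, -⟩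
      simp at h1 h2
      exact hds.differentiableAt (hU.mem_nhds (hsub z h2.le h1.le)))
  have hpt : ∀ ρ : ℝ, 0 < ρ → r ≤ ρ → ρ ≤ R → ρ ≠ ‖w‖ → (∮ ζ in C(0, ρ), dslope h w ζ) =
      (∮ ζ in C(0, ρ), (ζ - w)⁻¹ * h ζ) - (∮ ζ in C(0, ρ), (ζ - w)⁻¹) * h w := by
    intro ρ hρ h1 h2 h3
    have hne : ∀ ζ ∈ Metric.sphere (0:ℂ) ρ, ζ - w ≠ 0 := by
      intro ζ hζ h0
      rw [sub_eq_zero] at h0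
      subst h0; simp at hζ; exact h3 hζ.symm
    have hci : ContinuousOn (fun ζ : ℂ => (ζ - w)⁻¹) (Metric.sphere 0 ρ) :=
      ContinuousOn.inv₀ (by fun_prop) hne
    have hch : ContinuousOn h (Metric.sphere 0 ρ) := hh.continuousOn.mono (fun ζ hζ => by
      simp at hζ; exact hsub ζ (by linarith) (by linarith))
    have : (∮ ζ in C(0, ρ), (ζ - w)⁻¹) * h w = ∮ ζ in C(0, ρ), (ζ - w)⁻¹ * h w := by
      simp only [circleIntegral, smul_eq_mul, ← mul_assoc]
      rw [intervalIntegral.integral_mul_const]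
    rw [this, ← circleIntegral.integral_sub]
    · apply circleIntegral.integral_congr hρ.le
      intro ζ hζ
      have := hne ζ hζ
      simp only
      rw [dslope_of_ne _ (sub_ne_zero.1 this), slope_def_field]
      field_simp
    · exact (hci.mul hch).circleIntegrable hρ.le
    · exact (hci.mul continuousOn_const).circleIntegrable hρ.le
  rw [hpt R (by linarith) hrR.le le_rfl hw2.ne', hpt r hr le_rfl hrR.le hw1.ne] at e
  have i1 : (∮ ζ in C(0, R), (ζ - w)⁻¹) = 2 * Real.pi * I :=
    circleIntegral.integral_sub_inv_of_mem_ball (by simpa using hw2)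
  have i2 : (∮ ζ in C(0, r), (ζ - w)⁻¹) = 0 := by
    apply Complex.circleIntegral_eq_zero_of_differentiable_on_off_countable hr.le
      Set.countable_empty
    · apply ContinuousOn.inv₀ (by fun_prop)
      intro ζ hζ h0
      rw [sub_eq_zero] at h0
      subst h0; simp at hζ; linarith
    · intro z hz
      have : z - w ≠ 0 := by
        intro h0
        rw [sub_eq_zero] at h0
        subst h0; simp at hz; linarith
      fun_prop (disch := assumption)
  rw [i1, i2] at e
  linear_combination -e

open MeasureTheory in
lemma disc_mean {h : ℂ → ℂ} {c : ℂ} {r : ℝ} (hr : 0 < r) {U : Set ℂ} (hU : IsOpen U)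
    (hsub : Metric.closedBall c r ⊆ U) (hh : DifferentiableOn ℂ h U) :
    ∫ z in Metric.ball c r, h z = (Real.pi * r ^ 2 : ℝ) * h c := by
  have hmem : ∀ ρ θ : ℝ, 0 ≤ ρ → ρ ≤ r → circleMap c ρ θ ∈ Metric.closedBall c r := by
    intro ρ θ h1 h2
    simp [circleMap, abs_of_nonneg h1, h2]
  have inner : ∀ ρ ∈ Set.Ioo 0 r, ∫ θ in Set.Ioo (-Real.pi) Real.pi, ρ • h (circleMap c ρ θ) =
      ρ • ((2 * Real.pi : ℝ) * h c) := by
    intro ρ hρ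
    have hav : Real.circleAverage h c ρ = h c := by
      apply circleAverage_of_differentiable_on_off_countable Set.countable_empty
      · rw [abs_of_pos hρ.1]
        exact hh.continuousOn.mono ((Metric.closedBall_subset_closedBall hρ.2.le).trans hsub)
      · rintro z ⟨hz, -⟩
        rw [abs_of_pos hρ.1] at hz
        exact hh.differentiableAt (hU.mem_nhds (hsub
          (Metric.closedBall_subset_closedBall hρ.2.le (Metric.ball_subset_closedBall hz))))
    rw [integral_smul]
    congr 1
    rw [← integral_Ioc_eq_integral_Ioo, ← intervalIntegral.integral_of_le (by linarith [Real.pi_pos])]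
    have hper : Function.Periodic (fun θ => h (circleMap c ρ θ)) (2 * Real.pi) := fun θ => by
      simp only [periodic_circleMap c ρ θ]
    have := hper.intervalIntegral_add_eq (-Real.pi) 0
    rw [show -Real.pi + 2 * Real.pi = Real.pi by ring, zero_add] at this
    rw [this]
    rw [← hav, Real.circleAverage]
    rw [Complex.real_smul]
    have : (Real.pi : ℂ) ≠ 0 := by exact_mod_cast Real.pi_ne_zero
    push_cast
    field_simp
  have e1 : ∫ z in Metric.ball c r, h z =
      ∫ p in Set.Ioo 0 r ×ˢ Set.Ioo (-Real.pi) Real.pi, p.1 • h (circleMap c p.1 p.2) := by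
    rw [← integral_indicator measurableSet_ball, ← integral_add_right_eq_self _ c,
      ← Complex.integral_comp_polarCoord_symm]
    have hs : Set.Ioo 0 r ×ˢ Set.Ioo (-Real.pi) Real.pi ⊆ polarCoord.target := by
      rw [polarCoord_target]
      exact Set.prod_mono (fun x hx => hx.1) subset_rfl
    rw [setIntegral_eq_of_subset_of_forall_sdiff_eq_zero
      polarCoord.open_target.measurableSet hs]
    · apply setIntegral_congr_fun (measurableSet_Ioo.prod measurableSet_Ioo)
      rintro ⟨ρ, θ⟩ ⟨h1, h2⟩
      simp only at h1 h2 ⊢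
      have hc : Complex.polarCoord.symm (ρ, θ) + c = circleMap c ρ θ := by
        simp only [Complex.polarCoord_symm_apply, circleMap, Complex.exp_mul_I]
        push_cast
        ring
      rw [hc, Set.indicator_of_mem]
      simp [circleMap, abs_of_pos h1.1, h1.2]
    · rintro ⟨ρ, θ⟩ ⟨h1, h2⟩
      rw [polarCoord_target] at h1
      have h3 : r ≤ ρ := by
        by_contra hlt
        exact h2 ⟨⟨h1.1, not_le.1 hlt⟩, h1.2⟩
      have h0 : (0:ℝ) < ρ := h1.1
      rw [Set.indicator_of_notMem, smul_zero]
      rw [Metric.mem_ball, dist_eq_norm, add_sub_cancel_right, Complex.norm_polarCoord_symm, not_lt]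
      simpa [abs_of_pos h0] using h3
  have hint : IntegrableOn (fun p : ℝ × ℝ => p.1 • h (circleMap c p.1 p.2))
      (Set.Ioo 0 r ×ˢ Set.Ioo (-Real.pi) Real.pi) (volume.prod volume) := by
    have : IntegrableOn (fun p : ℝ × ℝ => p.1 • h (circleMap c p.1 p.2))
      (Set.Icc 0 r ×ˢ Set.Icc (-Real.pi) Real.pi) (volume.prod volume) := by
      apply ContinuousOn.integrableOn_compact (isCompact_Icc.prod isCompact_Icc)
      apply continuousOn_fst.smul
      apply hh.continuousOn.comp
      · unfold circleMap; fun_prop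
      · rintro ⟨ρ, θ⟩ ⟨h1, h2⟩
        exact hsub (hmem ρ θ h1.1 h1.2)
    exact this.mono_set (Set.prod_mono Set.Ioo_subset_Icc_self Set.Ioo_subset_Icc_self)
  rw [e1, Measure.volume_eq_prod, setIntegral_prod _ hint,
    setIntegral_congr_fun measurableSet_Ioo inner, integral_smul_const,
    ← integral_Ioc_eq_integral_Ioo, ← intervalIntegral.integral_of_le hr.le, integral_id,
    Complex.real_smul]
  push_cast
  ring

open MeasureTheory in
lemma ball_mean {h : ℂ × ℂ × ℂ → ℂ} {p : ℂ × ℂ × ℂ} {r : ℝ} (hr : 0 < r)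
    {W : Set (ℂ × ℂ × ℂ)} (hW : IsOpen W)
    (hsub : Metric.closedBall p r ⊆ W) (hh : DifferentiableOn ℂ h W) :
    ∫ z in Metric.ball p r, h z = (Real.pi * r ^ 2 : ℝ) ^ 3 * h p := by
  obtain ⟨p1, p2, p3⟩ := p
  have hint : IntegrableOn h (Metric.ball (p1, p2, p3) r) :=
    ((hh.continuousOn.mono hsub).integrableOn_compact (isCompact_closedBall _ _)).mono_set
      Metric.ball_subset_closedBall
  have hmem : ∀ x ∈ Metric.closedBall p1 r, ∀ y ∈ Metric.closedBall p2 r,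
      ∀ z ∈ Metric.closedBall p3 r, (x, y, z) ∈ W := by
    intro x hx y hy z hz
    apply hsub
    rw [← closedBall_prod_same, ← closedBall_prod_same]
    exact ⟨hx, hy, hz⟩
  have s3 : ∀ x ∈ Metric.closedBall p1 r, ∀ y ∈ Metric.closedBall p2 r,
      ∫ z in Metric.ball p3 r, h (x, y, z) = (Real.pi * r ^ 2 : ℝ) * h (x, y, p3) := by
    intro x hx y hy
    apply disc_mean (h := fun z => h (x, y, z)) hr
      (U := (fun z => (x, y, z)) ⁻¹' W) (hW.preimage (by fun_prop))
    · intro z hz; exact hmem x hx y hy z hz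
    · exact hh.comp (by fun_prop) (fun z hz => hz)
  have s2 : ∀ x ∈ Metric.closedBall p1 r,
      ∫ y in Metric.ball p2 r, h (x, y, p3) = (Real.pi * r ^ 2 : ℝ) * h (x, p2, p3) := by
    intro x hx
    apply disc_mean (h := fun y => h (x, y, p3)) hr
      (U := (fun y => (x, y, p3)) ⁻¹' W) (hW.preimage (by fun_prop))
    · intro y hy; exact hmem x hx y hy p3 (Metric.mem_closedBall_self hr.le)
    · exact hh.comp (by fun_prop) (fun z hz => hz)
  have s1 : ∫ x in Metric.ball p1 r, h (x, p2, p3) = (Real.pi * r ^ 2 : ℝ) * h (p1, p2, p3) := by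
    apply disc_mean (h := fun x => h (x, p2, p3)) hr
      (U := (fun x => (x, p2, p3)) ⁻¹' W) (hW.preimage (by fun_prop))
    · intro x hx
      exact hmem x hx p2 (Metric.mem_closedBall_self hr.le) p3 (Metric.mem_closedBall_self hr.le)
    · exact hh.comp (by fun_prop) (fun z hz => hz)
  have hB := Metric.ball_subset_closedBall (x := p1) (ε := r)
  rw [← ball_prod_same, Measure.volume_eq_prod] at hint ⊢
  rw [setIntegral_prod _ hint]
  have : Set.EqOn (fun x => ∫ y in Metric.ball (p2, p3) r, h (x, y))
      (fun x => (Real.pi * r ^ 2 : ℝ) ^ 2 * h (x, p2, p3)) (Metric.ball p1 r) := by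
    intro x hx
    have hx' := hB hx
    have hint2 : IntegrableOn (fun y => h (x, y)) (Metric.ball (p2, p3) r) := by
      have : ContinuousOn (fun y => h (x, y)) (Metric.closedBall (p2, p3) r) := by
        apply hh.continuousOn.comp (by fun_prop)
        rintro ⟨y, z⟩ hyz
        rw [← closedBall_prod_same] at hyz
        exact hmem x hx' y hyz.1 z hyz.2
      exact (this.integrableOn_compact (isCompact_closedBall _ _)).mono_set
        Metric.ball_subset_closedBall
    simp only
    rw [← ball_prod_same, Measure.volume_eq_prod] at hint2 ⊢
    rw [setIntegral_prod _ hint2, setIntegral_congr_fun measurableSet_ball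
      (fun y hy => s3 x hx' y (Metric.ball_subset_closedBall hy)), integral_const_mul, s2 x hx']
    ring
  rw [setIntegral_congr_fun measurableSet_ball this, integral_const_mul, s1]
  ring

open MeasureTheory in
lemma norm_le_of_L2 {h : ℂ × ℂ × ℂ → ℂ} {p : ℂ × ℂ × ℂ} {r : ℝ} (hr : 0 < r)
    {W : Set (ℂ × ℂ × ℂ)} (hW : IsOpen W)
    (hsub : Metric.closedBall p r ⊆ W) (hh : DifferentiableOn ℂ h W)
    (hL2 : IntegrableOn (fun z => ‖h z‖ ^ 2) W) {ε : ℝ} (hε : 0 < ε) :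
    ‖h p‖ ≤ ε / 2 + ((Real.pi * r ^ 2) ^ 3)⁻¹ * (2 * ε)⁻¹ * ∫ z in W, ‖h z‖ ^ 2 := by
  set V : ℝ := (Real.pi * r ^ 2) ^ 3 with hV
  have hVpos : 0 < V := by have := Real.pi_pos; positivity
  have hbW : Metric.ball p r ⊆ W := Metric.ball_subset_closedBall.trans hsub
  have hvol : volume.real (Metric.ball p r) = V := by
    have := ball_mean (h := fun _ => 1) hr hW hsub (differentiableOn_const _)
    simp only [setIntegral_const, mul_one, Complex.real_smul] at this
    exact_mod_cast this
  have hm := ball_mean hr hW hsub hh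
  have h1 : V * ‖h p‖ ≤ ∫ z in Metric.ball p r, ‖h z‖ := by
    calc V * ‖h p‖ = ‖∫ z in Metric.ball p r, h z‖ := by
          rw [hm, norm_mul, ← Complex.ofReal_pow, Complex.norm_real, ← hV, Real.norm_of_nonneg hVpos.le]
      _ ≤ _ := norm_integral_le_integral_norm _
  have hi1 : IntegrableOn h (Metric.ball p r) :=
    ((hh.continuousOn.mono hsub).integrableOn_compact (isCompact_closedBall _ _)).mono_set
      Metric.ball_subset_closedBall
  have hi2 : IntegrableOn (fun z => ‖h z‖ ^ 2) (Metric.ball p r) := hL2.mono_set hbW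
  have hi3 : IntegrableOn (fun _ => ε / 2) (Metric.ball p r) :=
    integrableOn_const (measure_ball_lt_top.ne)
  have h2 : ∫ z in Metric.ball p r, ‖h z‖ ≤
      ∫ z in Metric.ball p r, (ε / 2 + (2 * ε)⁻¹ * ‖h z‖ ^ 2) := by
    apply setIntegral_mono hi1.norm (hi3.add (hi2.const_mul _))
    intro z
    change ‖h z‖ ≤ ε / 2 + (2 * ε)⁻¹ * ‖h z‖ ^ 2
    have : 0 ≤ (2 * ε)⁻¹ * (‖h z‖ - ε) ^ 2 := by positivity
    have e : (2 * ε)⁻¹ * (‖h z‖ - ε) ^ 2 = ε / 2 + (2 * ε)⁻¹ * ‖h z‖ ^ 2 - ‖h z‖ := by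
      field_simp; ring
    linarith
  rw [integral_add hi3 (hi2.const_mul _), integral_const_mul, setIntegral_const, hvol,
    smul_eq_mul] at h2
  have h3 : ∫ z in Metric.ball p r, ‖h z‖ ^ 2 ≤ ∫ z in W, ‖h z‖ ^ 2 :=
    setIntegral_mono_set hL2 (Filter.Eventually.of_forall fun z => by positivity)
      hbW.eventuallyLE
  have h4 : V * ‖h p‖ ≤ V * (ε / 2) + (2 * ε)⁻¹ * ∫ z in W, ‖h z‖ ^ 2 := by
    have : (2 * ε)⁻¹ * ∫ z in Metric.ball p r, ‖h z‖ ^ 2 ≤ (2 * ε)⁻¹ * ∫ z in W, ‖h z‖ ^ 2 := by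
      gcongr
    linarith
  rw [← mul_le_mul_iff_of_pos_left hVpos]
  refine h4.trans (le_of_eq ?_)
  field_simp

/-- The iterated Cauchy-type integral over a product of two circles. -/
noncomputable def torusInt (g : ℂ × ℂ × ℂ → ℂ) (ρ σ : ℝ) (z : ℂ × ℂ × ℂ) : ℂ :=
  ∮ ζ in C(0, ρ), ∮ ξ in C(0, σ), (ζ - z.2.1)⁻¹ * (ξ - z.2.2)⁻¹ * g (z.1, ζ, ξ)

/-- The Cauchy transform over the distinguished boundary of a product of two annuli. -/
noncomputable def cauchyExt (g : ℂ × ℂ × ℂ → ℂ) (r R : ℝ) (z : ℂ × ℂ × ℂ) : ℂ :=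
  ((2 * Real.pi * I) ^ 2)⁻¹ * (torusInt g R R z - torusInt g R r z - torusInt g r R z
    + torusInt g r r z)

lemma isOpen_forall_mem {E : Type*} [TopologicalSpace E] {K : Set ℂ} (hK : IsCompact K)
    {O : Set (E × ℂ)} (hO : IsOpen O) : IsOpen {e : E | ∀ ξ ∈ K, (e, ξ) ∈ O} := by
  rw [isOpen_iff_eventually]
  intro e he
  exact hK.eventually_forall_of_forall_eventually (fun ξ hξ => hO.mem_nhds (he ξ hξ))

lemma inner_diff {W : Set (ℂ × ℂ × ℂ)} (hW : IsOpen W) {g : ℂ × ℂ × ℂ → ℂ}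
    (hg : DifferentiableOn ℂ g W) {σ : ℝ} (hσ : 0 ≤ σ) :
    ∃ O : Set ((ℂ × ℂ × ℂ) × ℂ), IsOpen O ∧
      (∀ (z : ℂ × ℂ × ℂ) (ζ : ℂ), (∀ ξ ∈ Metric.sphere (0:ℂ) σ, (z.1, ζ, ξ) ∈ W) → ζ ≠ z.2.1 →
        ‖z.2.2‖ ≠ σ → (z, ζ) ∈ O) ∧
      DifferentiableOn ℂ (fun q : (ℂ × ℂ × ℂ) × ℂ => ∮ ξ in C(0, σ),
        (q.2 - q.1.2.1)⁻¹ * (ξ - q.1.2.2)⁻¹ * g (q.1.1, q.2, ξ)) O := by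
  set O1 : Set (((ℂ × ℂ × ℂ) × ℂ) × ℂ) := {q | (q.1.1.1, q.1.2, q.2) ∈ W ∧
    q.1.2 - q.1.1.2.1 ≠ 0 ∧ q.2 - q.1.1.2.2 ≠ 0} with hO1
  have hO1o : IsOpen O1 := by
    apply IsOpen.inter
    · exact hW.preimage (by fun_prop)
    · exact (isOpen_ne_fun (by fun_prop) (by fun_prop)).inter
        (isOpen_ne_fun (by fun_prop) (by fun_prop))
  refine ⟨_, isOpen_forall_mem (isCompact_sphere (0:ℂ) σ) hO1o, ?_, ?_⟩
  · intro z ζ h1 h2 h3 ξ hξ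
    refine ⟨h1 ξ hξ, sub_ne_zero.2 h2, sub_ne_zero.2 ?_⟩
    rintro h
    rw [mem_sphere_zero_iff_norm] at hξ
    exact h3 (by rw [← hξ]; exact congrArg _ h.symm)
  · intro q hq
    apply DifferentiableAt.differentiableWithinAt
    apply circleIntegral_differentiable (G := fun q : ((ℂ × ℂ × ℂ) × ℂ) × ℂ =>
      (q.1.2 - q.1.1.2.1)⁻¹ * (q.2 - q.1.1.2.2)⁻¹ * g (q.1.1.1, q.1.2, q.2)) hO1o _ hσ hq
    apply DifferentiableOn.mul
    · apply DifferentiableOn.mul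
      · exact DifferentiableOn.inv (by fun_prop) (fun x hx => hx.2.1)
      · exact DifferentiableOn.inv (by fun_prop) (fun x hx => hx.2.2)
    · exact hg.comp (t := W) (f := fun q : ((ℂ × ℂ × ℂ) × ℂ) × ℂ => (q.1.1.1, q.1.2, q.2))
        (by fun_prop) (fun x hx => hx.1)

lemma torusInt_diff {W : Set (ℂ × ℂ × ℂ)} (hW : IsOpen W) {g : ℂ × ℂ × ℂ → ℂ}
    (hg : DifferentiableOn ℂ g W) {ρ σ : ℝ} (hρ : 0 ≤ ρ) (hσ : 0 ≤ σ) {z : ℂ × ℂ × ℂ}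
    (hz : ∀ ζ ∈ Metric.sphere (0:ℂ) ρ, ∀ ξ ∈ Metric.sphere (0:ℂ) σ, (z.1, ζ, ξ) ∈ W)
    (h2 : ‖z.2.1‖ ≠ ρ) (h3 : ‖z.2.2‖ ≠ σ) : DifferentiableAt ℂ (torusInt g ρ σ) z := by
  obtain ⟨O, hO, hmem, hd⟩ := inner_diff hW hg hσ
  exact circleIntegral_differentiable hO hd hρ (fun ζ hζ => hmem z ζ (hz ζ hζ) (by
    rintro rfl
    rw [mem_sphere_zero_iff_norm] at hζ
    exact h2 hζ) h3)

lemma torusInt_tendsto {W : Set (ℂ × ℂ × ℂ)} (hW : IsOpen W) {g : ℂ × ℂ × ℂ → ℂ}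
    {gs : ℕ → ℂ × ℂ × ℂ → ℂ}
    (hg : DifferentiableOn ℂ g W) (hgs : ∀ n, DifferentiableOn ℂ (gs n) W)
    (hu : ∀ K ⊆ W, IsCompact K → ∀ ε > 0, ∀ᶠ n in Filter.atTop, ∀ p ∈ K, ‖gs n p - g p‖ ≤ ε)
    {ρ σ : ℝ} (hρ : 0 ≤ ρ) (hσ : 0 ≤ σ) {z : ℂ × ℂ × ℂ}
    (hz : ∀ ζ ∈ Metric.sphere (0:ℂ) ρ, ∀ ξ ∈ Metric.sphere (0:ℂ) σ, (z.1, ζ, ξ) ∈ W)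
    (h2 : ‖z.2.1‖ ≠ ρ) (h3 : ‖z.2.2‖ ≠ σ) :
    Filter.Tendsto (fun n => torusInt (gs n) ρ σ z) Filter.atTop (nhds (torusInt g ρ σ z)) := by
  have n2 : ∀ ζ ∈ Metric.sphere (0:ℂ) ρ, ζ - z.2.1 ≠ 0 := by
    intro ζ hζ h
    rw [sub_eq_zero] at h
    rw [mem_sphere_zero_iff_norm, h] at hζ
    exact h2 hζ
  have n3 : ∀ ζ ∈ Metric.sphere (0:ℂ) σ, ζ - z.2.2 ≠ 0 := by
    intro ζ hζ h
    rw [sub_eq_zero] at h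
    rw [mem_sphere_zero_iff_norm, h] at hζ
    exact h3 hζ
  have c2 : ContinuousOn (fun ζ : ℂ => (ζ - z.2.1)⁻¹) (Metric.sphere 0 ρ) :=
    ContinuousOn.inv₀ (by fun_prop) n2
  have c3 : ContinuousOn (fun ζ : ℂ => (ζ - z.2.2)⁻¹) (Metric.sphere 0 σ) :=
    ContinuousOn.inv₀ (by fun_prop) n3
  obtain ⟨M2, hM2⟩ := (isCompact_sphere (0:ℂ) ρ).exists_bound_of_continuousOn c2
  obtain ⟨M3, hM3⟩ := (isCompact_sphere (0:ℂ) σ).exists_bound_of_continuousOn c3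
  have iInner : ∀ k : ℂ × ℂ × ℂ → ℂ, DifferentiableOn ℂ k W → ∀ ζ ∈ Metric.sphere (0:ℂ) ρ,
      CircleIntegrable (fun ξ => (ζ - z.2.1)⁻¹ * (ξ - z.2.2)⁻¹ * k (z.1, ζ, ξ)) 0 σ := by
    intro k hk ζ hζ
    apply ContinuousOn.circleIntegrable hσ
    apply ContinuousOn.mul (continuousOn_const.mul c3)
    exact hk.continuousOn.comp (by fun_prop) (fun ξ hξ => hz ζ hζ ξ hξ)
  have iOuter : ∀ k : ℂ × ℂ × ℂ → ℂ, DifferentiableOn ℂ k W → CircleIntegrable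
      (fun ζ => ∮ ξ in C(0, σ), (ζ - z.2.1)⁻¹ * (ξ - z.2.2)⁻¹ * k (z.1, ζ, ξ)) 0 ρ := by
    intro k hk
    apply ContinuousOn.circleIntegrable hρ
    obtain ⟨O, hO, hmem, hd⟩ := inner_diff hW hk hσ
    exact hd.continuousOn.comp (f := fun ζ : ℂ => (z, ζ)) (by fun_prop)
      (fun ζ hζ => hmem z ζ (hz ζ hζ) (sub_ne_zero.1 (n2 ζ hζ)) h3)
  rw [Metric.tendsto_atTop']
  intro ε hε
  set A : ℝ := 2 * Real.pi * ρ * (2 * Real.pi * σ * (|M2| * |M3|)) with hA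
  have hA0 : 0 ≤ A := by have := Real.pi_pos; positivity
  set K : Set (ℂ × ℂ × ℂ) := {z.1} ×ˢ Metric.sphere (0:ℂ) ρ ×ˢ Metric.sphere (0:ℂ) σ with hK
  have hKc : IsCompact K := isCompact_singleton.prod ((isCompact_sphere _ _).prod (isCompact_sphere _ _))
  have hKW : K ⊆ W := by
    rintro ⟨x, ζ, ξ⟩ ⟨hx, hζ, hξ⟩
    simp only [Set.mem_singleton_iff] at hx
    subst hx
    exact hz ζ hζ ξ hξ
  set η : ℝ := ε / (A + 1) with hη
  have hη0 : 0 < η := by positivity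
  obtain ⟨N, hN⟩ := Filter.eventually_atTop.1 (hu K hKW hKc η hη0)
  refine ⟨N, fun n hn => ?_⟩
  have hb := hN n hn.le
  rw [dist_eq_norm, torusInt, torusInt, ← circleIntegral.integral_sub (iOuter _ (hgs n)) (iOuter _ hg)]
  have : A * η < ε := by
    rw [hη, mul_div_assoc', div_lt_iff₀ (by positivity)]; nlinarith
  refine lt_of_le_of_lt ?_ this
  rw [show A * η = 2 * Real.pi * ρ * (2 * Real.pi * σ * (|M2| * |M3| * η)) by rw [hA]; ring]
  apply circleIntegral.norm_integral_le_of_norm_le_const hρ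
  intro ζ hζ
  rw [← circleIntegral.integral_sub (iInner _ (hgs n) ζ hζ) (iInner _ hg ζ hζ)]
  apply circleIntegral.norm_integral_le_of_norm_le_const hσ
  intro ξ hξ
  rw [← mul_sub, norm_mul, norm_mul]
  have t1 := (hM2 ζ hζ).trans (le_abs_self M2)
  have t2 := (hM3 ξ hξ).trans (le_abs_self M3)
  have t3 := hb (z.1, ζ, ξ) ⟨rfl, hζ, hξ⟩
  gcongr

lemma cauchyExt_eq {g : ℂ × ℂ × ℂ → ℂ} {Y : Set (ℂ × ℂ × ℂ)} (hY : IsOpen Y)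
    (hg : DifferentiableOn ℂ g Y) {r R : ℝ} (hr : 0 < r) (hrR : r < R) {z : ℂ × ℂ × ℂ}
    (hz : ∀ ζ ξ : ℂ, r ≤ ‖ζ‖ → ‖ζ‖ ≤ R → r ≤ ‖ξ‖ → ‖ξ‖ ≤ R → (z.1, ζ, ξ) ∈ Y)
    (h1 : r < ‖z.2.1‖) (h2 : ‖z.2.1‖ < R) (h3 : r < ‖z.2.2‖) (h4 : ‖z.2.2‖ < R) :
    cauchyExt g r R z = g z := by
  have hπ : (2 * Real.pi * I : ℂ) ≠ 0 := by
    simp [Real.pi_ne_zero]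
  -- Cauchy formula in the last variable
  have s3 : ∀ ζ : ℂ, r ≤ ‖ζ‖ → ‖ζ‖ ≤ R → (2 * Real.pi * I) * g (z.1, ζ, z.2.2) =
      (∮ ξ in C(0, R), (ξ - z.2.2)⁻¹ * g (z.1, ζ, ξ)) -
        ∮ ξ in C(0, r), (ξ - z.2.2)⁻¹ * g (z.1, ζ, ξ) := by
    intro ζ k1 k2
    apply cauchy_annulus hr hrR (h := fun ξ => g (z.1, ζ, ξ))
      (U := (fun ξ => (z.1, ζ, ξ)) ⁻¹' Y) (hY.preimage (by fun_prop))
      (fun ξ k3 k4 => hz ζ ξ k1 k2 k3 k4) (hg.comp (by fun_prop) (fun x hx => hx)) h3 h4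
  have s2 : (2 * Real.pi * I) * g (z.1, z.2.1, z.2.2) =
      (∮ ζ in C(0, R), (ζ - z.2.1)⁻¹ * g (z.1, ζ, z.2.2)) -
        ∮ ζ in C(0, r), (ζ - z.2.1)⁻¹ * g (z.1, ζ, z.2.2) := by
    apply cauchy_annulus hr hrR (h := fun ζ => g (z.1, ζ, z.2.2))
      (U := (fun ζ => (z.1, ζ, z.2.2)) ⁻¹' Y) (hY.preimage (by fun_prop))
      (fun ζ k1 k2 => hz ζ z.2.2 k1 k2 h3.le h4.le) (hg.comp (by fun_prop) (fun x hx => hx)) h1 h2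
  have iOuter : ∀ ρ, 0 ≤ ρ → r ≤ ρ → ρ ≤ R → ρ ≠ ‖z.2.1‖ → ∀ σ, 0 ≤ σ → r ≤ σ → σ ≤ R →
      ‖z.2.2‖ ≠ σ → CircleIntegrable
      (fun ζ => ∮ ξ in C(0, σ), (ζ - z.2.1)⁻¹ * (ξ - z.2.2)⁻¹ * g (z.1, ζ, ξ)) 0 ρ := by
    intro ρ hρ a1 a2 a3 σ hσ b1 b2 b3
    apply ContinuousOn.circleIntegrable hρ
    obtain ⟨O, hO, hmem, hd⟩ := inner_diff hY hg hσ
    refine hd.continuousOn.comp (f := fun ζ : ℂ => (z, ζ)) (by fun_prop)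
      (fun ζ hζ => hmem z ζ (fun ξ hξ => ?_) ?_ b3)
    · rw [mem_sphere_zero_iff_norm] at hζ hξ
      apply hz <;> linarith
    · rintro rfl
      rw [mem_sphere_zero_iff_norm] at hζ
      exact a3 hζ.symm
  have comb : ∀ ρ, 0 ≤ ρ → r ≤ ρ → ρ ≤ R → ρ ≠ ‖z.2.1‖ →
      torusInt g ρ R z - torusInt g ρ r z =
      (2 * Real.pi * I) * ∮ ζ in C(0, ρ), (ζ - z.2.1)⁻¹ * g (z.1, ζ, z.2.2) := by
    intro ρ hρ a1 a2 a3
    rw [torusInt, torusInt, ← circleIntegral.integral_sub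
      (iOuter ρ hρ a1 a2 a3 R (by linarith) hrR.le le_rfl h4.ne)
      (iOuter ρ hρ a1 a2 a3 r hr.le le_rfl hrR.le h3.ne'),
      ← circleIntegral.integral_const_mul]
    apply circleIntegral.integral_congr hρ
    intro ζ hζ
    rw [mem_sphere_zero_iff_norm] at hζ
    have := s3 ζ (by linarith) (by linarith)
    simp only [mul_assoc] at this ⊢
    rw [circleIntegral.integral_const_mul, circleIntegral.integral_const_mul, ← mul_sub, ← this]
    ring
  have e1 := comb R (by linarith) hrR.le le_rfl h2.ne'
  have e2 := comb r hr.le le_rfl hrR.le h1.ne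
  rw [cauchyExt, inv_mul_eq_iff_eq_mul₀ (pow_ne_zero 2 hπ)]
  change _ = _ * g (z.1, z.2.1, z.2.2)
  linear_combination e1 - e2 - (2 * Real.pi * I) * s2

lemma eq_on_lens {c c' : ℂ} (hc : ‖c‖ = 1) (hc' : ‖c'‖ = 1) {k1 k2 : ℂ → ℂ}
    (h1 : DifferentiableOn ℂ k1 (Metric.ball c 1)) (h2 : DifferentiableOn ℂ k2 (Metric.ball c' 1))
    {δ : ℝ} (hδ : 0 < δ)
    (heq : ∀ w ∈ Metric.ball c 1, w ∈ Metric.ball c' 1 → ‖w‖ < δ → k1 w = k2 w)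
    {w : ℂ} (hw : w ∈ Metric.ball c 1) (hw' : w ∈ Metric.ball c' 1) : k1 w = k2 w := by
  set S := Metric.ball c 1 ∩ Metric.ball c' 1 with hS
  have hSo : IsOpen S := Metric.isOpen_ball.inter Metric.isOpen_ball
  have hSc : Convex ℝ S := (convex_ball c 1).inter (convex_ball c' 1)
  have hscale : ∀ d : ℂ, ‖d‖ = 1 → w ∈ Metric.ball d 1 → ∀ t : ℝ, 0 < t → t ≤ 1 →
      (t : ℂ) * w ∈ Metric.ball d 1 := by
    intro d hd hwd t ht ht1
    rw [Metric.mem_ball, dist_eq_norm] at *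
    calc ‖(t : ℂ) * w - d‖ = ‖(t : ℂ) * (w - d) + ((1 - t : ℝ) : ℂ) * (-d)‖ := by
          congr 1; push_cast; ring
      _ ≤ ‖(t : ℂ) * (w - d)‖ + ‖((1 - t : ℝ) : ℂ) * (-d)‖ := norm_add_le _ _
      _ = t * ‖w - d‖ + (1 - t) := by
          rw [norm_mul, norm_mul, Complex.norm_real, Complex.norm_real, norm_neg, hd,
            Real.norm_of_nonneg ht.le, Real.norm_of_nonneg (by linarith), mul_one]
      _ < 1 := by nlinarith
  set t : ℝ := min 1 (δ / (2 * (‖w‖ + 1))) with ht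
  have ht0 : 0 < t := by positivity
  have ht1 : t ≤ 1 := min_le_left _ _
  have hsmall : ‖(t : ℂ) * w‖ < δ := by
    rw [norm_mul, Complex.norm_real, Real.norm_of_nonneg ht0.le]
    have : t ≤ δ / (2 * (‖w‖ + 1)) := min_le_right _ _
    rw [le_div_iff₀ (by positivity)] at this
    nlinarith [norm_nonneg w]
  have hmem : (t : ℂ) * w ∈ S := ⟨hscale c hc hw t ht0 ht1, hscale c' hc' hw' t ht0 ht1⟩
  have ha1 : AnalyticOnNhd ℂ k1 S := (h1.mono Set.inter_subset_left).analyticOnNhd hSo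
  have ha2 : AnalyticOnNhd ℂ k2 S := (h2.mono Set.inter_subset_right).analyticOnNhd hSo
  refine ha1.eqOn_of_preconnected_of_eventuallyEq ha2 hSc.isPreconnected hmem ?_ ⟨hw, hw'⟩
  filter_upwards [hSo.mem_nhds hmem, (Metric.isOpen_ball (x := (0:ℂ)) (ε := δ)).mem_nhds
    (by simpa using hsmall)] with v hv hv'
  exact heq v hv.1 hv.2 (by simpa using hv')

lemma Lofz_eq (z : ℂ × ℂ × ℂ) (h2 : z.2.1 ≠ 0) (h3 : z.2.2 ≠ 0) :
    Lofz z = Real.log (‖z.2.1‖ ^ 2) + Real.log (‖z.2.2‖ ^ 2) := by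
  rw [Lofz, norm_mul, mul_pow, Real.log_mul]
  · exact pow_ne_zero 2 (norm_ne_zero_iff.2 h2)
  · exact pow_ne_zero 2 (norm_ne_zero_iff.2 h3)

lemma lt_log_sq {w : ℂ} (hw : w ≠ 0) (a : ℝ) :
    a < Real.log (‖w‖ ^ 2) ↔ Real.exp (a / 2) < ‖w‖ := by
  rw [Real.log_pow, ← Real.lt_log_iff_exp_lt (norm_pos_iff.2 hw)]
  push_cast
  constructor <;> intro h <;> linarith

lemma log_sq_lt {w : ℂ} (hw : w ≠ 0) (a : ℝ) :
    Real.log (‖w‖ ^ 2) < a ↔ ‖w‖ < Real.exp (a / 2) := by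
  rw [Real.log_pow, ← Real.log_lt_iff_lt_exp (norm_pos_iff.2 hw)]
  push_cast
  constructor <;> intro h <;> linarith

lemma log_sq_of_norm {w : ℂ} {a : ℝ} (h : ‖w‖ = Real.exp (a / 2)) :
    w ≠ 0 ∧ Real.log (‖w‖ ^ 2) = a := by
  refine ⟨norm_pos_iff.1 (by rw [h]; positivity), ?_⟩
  rw [h, Real.log_pow, Real.log_exp]
  push_cast
  ring

lemma norm_exp_I_mul (x : ℝ) : ‖Complex.exp (Complex.I * (x : ℂ))‖ = 1 := by
  rw [mul_comm]; exact Complex.norm_exp_ofReal_mul_I x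

lemma norm_exp_two_I_mul (x : ℝ) : ‖Complex.exp (2 * Complex.I * (x : ℂ))‖ = 1 := by
  have := norm_exp_I_mul (2 * x)
  push_cast at this
  rwa [show 2 * I * (x : ℂ) = I * (2 * x) by ring]

lemma isOpen_wormTrunc (μ : ℝ) : IsOpen (wormTrunc μ) := by
  rw [isOpen_iff_mem_nhds]
  rintro z ⟨h2, h3, h1, a1, a2, b1, b2⟩
  have n2 : ‖z.2.1‖ ^ 2 ≠ 0 := pow_ne_zero 2 (norm_ne_zero_iff.2 h2)
  have n3 : ‖z.2.2‖ ^ 2 ≠ 0 := pow_ne_zero 2 (norm_ne_zero_iff.2 h3)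
  have n23 : ‖z.2.1 * z.2.2‖ ^ 2 ≠ 0 := pow_ne_zero 2 (norm_ne_zero_iff.2 (mul_ne_zero h2 h3))
  have c2 : ContinuousAt (fun z : ℂ × ℂ × ℂ => Real.log (‖z.2.1‖ ^ 2)) z :=
    ContinuousAt.log (by fun_prop) n2
  have c3 : ContinuousAt (fun z : ℂ × ℂ × ℂ => Real.log (‖z.2.2‖ ^ 2)) z :=
    ContinuousAt.log (by fun_prop) n3
  have cL : ContinuousAt Lofz z :=
    ContinuousAt.log (f := fun z : ℂ × ℂ × ℂ => ‖z.2.1 * z.2.2‖ ^ 2) (by fun_prop) n23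
  have c1 : ContinuousAt (fun z : ℂ × ℂ × ℂ =>
      ‖z.1 - Complex.exp (Complex.I * (Lofz z : ℂ))‖) z := by fun_prop
  have d2 : ContinuousAt (fun z : ℂ × ℂ × ℂ => z.2.1) z := by fun_prop
  have d3 : ContinuousAt (fun z : ℂ × ℂ × ℂ => z.2.2) z := by fun_prop
  filter_upwards [d2.eventually_ne h2, d3.eventually_ne h3, c1.eventually_lt_const h1,
    c2.eventually_const_lt a1, c2.eventually_lt_const a2,
    c3.eventually_const_lt b1, c3.eventually_lt_const b2] with w e1 e2 e3 e4 e5 e6 e7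
  exact ⟨e1, e2, e3, e4, e5, e6, e7⟩

lemma isCompact_closure_wormTrunc (μ : ℝ) : IsCompact (closure (wormTrunc μ)) := by
  apply Bornology.IsBounded.isCompact_closure
  apply (Metric.isBounded_closedBall (x := (0 : ℂ × ℂ × ℂ))
    (r := max 2 (Real.exp (μ / 2)))).subset
  rintro z ⟨h2, h3, h1, a1, a2, b1, b2⟩
  rw [log_sq_lt h2] at a2
  rw [log_sq_lt h3] at b2
  rw [mem_closedBall_zero_iff, Prod.norm_def, Prod.norm_def]
  have : ‖z.1‖ ≤ 2 := by
    have e := norm_exp_I_mul (Lofz z)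
    calc ‖z.1‖ = ‖(z.1 - Complex.exp (Complex.I * (Lofz z : ℂ))) +
          Complex.exp (Complex.I * (Lofz z : ℂ))‖ := by rw [sub_add_cancel]
      _ ≤ _ := norm_add_le _ _
      _ ≤ 2 := by linarith
  exact max_le (this.trans (le_max_left _ _))
    (max_le (a2.le.trans (le_max_right _ _)) (b2.le.trans (le_max_right _ _)))

lemma zero_mem_closure {μ : ℝ} {ζ ξ : ℂ} (h2 : ζ ≠ 0) (h3 : ξ ≠ 0)
    (a1 : -μ < Real.log (‖ζ‖ ^ 2)) (a2 : Real.log (‖ζ‖ ^ 2) < μ)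
    (b1 : -μ < Real.log (‖ξ‖ ^ 2)) (b2 : Real.log (‖ξ‖ ^ 2) < μ) :
    ((0 : ℂ), ζ, ξ) ∈ closure (wormTrunc μ) := by
  set c : ℂ := Complex.exp (Complex.I * (Lofz ((0:ℂ), ζ, ξ) : ℂ)) with hc
  have hcn : ‖c‖ = 1 := norm_exp_I_mul _
  have ht : Filter.Tendsto (fun t : ℝ => ((t : ℂ) * c, ζ, ξ)) (nhdsWithin 0 (Set.Ioi 0))
      (nhds ((0:ℂ), ζ, ξ)) := by
    have : Continuous (fun t : ℝ => ((t : ℂ) * c, ζ, ξ)) := by fun_prop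
    have h := this.tendsto 0
    simp only [Complex.ofReal_zero, zero_mul] at h
    exact h.mono_left nhdsWithin_le_nhds
  apply mem_closure_of_tendsto ht
  filter_upwards [Ioo_mem_nhdsGT (show (0:ℝ) < 1 by norm_num)] with t htt
  refine ⟨h2, h3, ?_, a1, a2, b1, b2⟩
  change ‖(t : ℂ) * c - c‖ < 1
  rw [show (t : ℂ) * c - c = ((t - 1 : ℝ) : ℂ) * c by push_cast; ring, norm_mul, hcn, mul_one,
    Complex.norm_real, Real.norm_eq_abs, abs_lt]
  constructor <;> linarith [htt.1, htt.2]

/-- The piece attached at the parameter `a`. -/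
def wormPiece (a : ℝ) : Set (ℂ × ℂ × ℂ) :=
  {z : ℂ × ℂ × ℂ |
        ‖z.1 - Complex.exp (2 * Complex.I * (a : ℂ))‖ < 1 ∧
        z.2.1 ≠ 0 ∧ a < Real.log (‖z.2.1‖ ^ 2) ∧
          Real.log (‖z.2.1‖ ^ 2) < a + 2 * Real.pi ∧
        z.2.2 ≠ 0 ∧ a < Real.log (‖z.2.2‖ ^ 2) ∧
          Real.log (‖z.2.2‖ ^ 2) < a + 2 * Real.pi}

lemma isOpen_wormPiece (a : ℝ) : IsOpen (wormPiece a) := by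
  rw [isOpen_iff_mem_nhds]
  rintro z ⟨h1, h2, a1, a2, h3, b1, b2⟩
  have n2 : ‖z.2.1‖ ^ 2 ≠ 0 := pow_ne_zero 2 (norm_ne_zero_iff.2 h2)
  have n3 : ‖z.2.2‖ ^ 2 ≠ 0 := pow_ne_zero 2 (norm_ne_zero_iff.2 h3)
  have c2 : ContinuousAt (fun z : ℂ × ℂ × ℂ => Real.log (‖z.2.1‖ ^ 2)) z :=
    ContinuousAt.log (by fun_prop) n2
  have c3 : ContinuousAt (fun z : ℂ × ℂ × ℂ => Real.log (‖z.2.2‖ ^ 2)) z :=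
    ContinuousAt.log (by fun_prop) n3
  have c1 : ContinuousAt (fun z : ℂ × ℂ × ℂ =>
      ‖z.1 - Complex.exp (2 * Complex.I * (a : ℂ))‖) z := by fun_prop
  have d2 : ContinuousAt (fun z : ℂ × ℂ × ℂ => z.2.1) z := by fun_prop
  have d3 : ContinuousAt (fun z : ℂ × ℂ × ℂ => z.2.2) z := by fun_prop
  filter_upwards [d2.eventually_ne h2, d3.eventually_ne h3, c1.eventually_lt_const h1,
    c2.eventually_const_lt a1, c2.eventually_lt_const a2,
    c3.eventually_const_lt b1, c3.eventually_lt_const b2] with w e1 e2 e3 e4 e5 e6 e7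
  exact ⟨e3, e1, e4, e5, e2, e6, e7⟩

/-- inner radius -/
noncomputable def rin (a : ℝ) : ℝ := Real.exp (a / 2)
/-- outer radius -/
noncomputable def rout (a : ℝ) : ℝ := Real.exp ((a + 2 * Real.pi) / 2)

lemma rin_pos (a : ℝ) : 0 < rin a := Real.exp_pos _
lemma rin_lt_rout (a : ℝ) : rin a < rout a := by
  apply Real.exp_lt_exp.2
  linarith [Real.pi_pos]

lemma corner_mem {μ a : ℝ} (ha : a ∈ Set.Ioo (-μ / 2) (μ / 2 - 2 * Real.pi)) {z1 ζ ξ : ℂ}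
    (hz : ‖z1 - Complex.exp (2 * Complex.I * (a : ℂ))‖ < 1)
    (hζ : ‖ζ‖ = rin a ∨ ‖ζ‖ = rout a) (hξ : ‖ξ‖ = rin a ∨ ‖ξ‖ = rout a) :
    (z1, ζ, ξ) ∈ wormTrunc μ := by
  have hπ := Real.pi_pos
  obtain ⟨ha1, ha2⟩ := ha
  have key : ∀ w : ℂ, (‖w‖ = rin a ∨ ‖w‖ = rout a) → w ≠ 0 ∧ ∃ k : ℕ, k ≤ 1 ∧
      Real.log (‖w‖ ^ 2) = a + k * (2 * Real.pi) := by
    rintro w (h | h)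
    · exact ⟨(log_sq_of_norm h).1, 0, by norm_num, by rw [(log_sq_of_norm h).2]; simp⟩
    · exact ⟨(log_sq_of_norm h).1, 1, by norm_num, by rw [(log_sq_of_norm h).2]; simp⟩
  obtain ⟨n2, k, hk, e2⟩ := key ζ hζ
  obtain ⟨n3, l, hl, e3⟩ := key ξ hξ
  have hL := Lofz_eq (z1, ζ, ξ) n2 n3
  simp only [e2, e3] at hL
  have hk' : (k : ℝ) ≤ 1 := by exact_mod_cast hk
  have hl' : (l : ℝ) ≤ 1 := by exact_mod_cast hl
  have hk0 : (0 : ℝ) ≤ k := by positivity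
  have hl0 : (0 : ℝ) ≤ l := by positivity
  refine ⟨n2, n3, ?_, ?_, ?_, ?_, ?_⟩
  · rw [hL]
    have : Complex.exp (I * ((a + k * (2 * Real.pi) + (a + l * (2 * Real.pi)) : ℝ) : ℂ)) =
        Complex.exp (2 * I * a) := by
      rw [Complex.exp_eq_exp_iff_exists_int]
      refine ⟨(k + l : ℕ), ?_⟩
      push_cast
      ring
    rw [this]
    exact hz
  all_goals simp only [e2, e3]; nlinarith

lemma piece_norms {a : ℝ} {z : ℂ × ℂ × ℂ} (hz : z ∈ wormPiece a) :
    rin a < ‖z.2.1‖ ∧ ‖z.2.1‖ < rout a ∧ rin a < ‖z.2.2‖ ∧ ‖z.2.2‖ < rout a := by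
  obtain ⟨h1, h2, a1, a2, h3, b1, b2⟩ := hz
  exact ⟨(lt_log_sq h2 _).1 a1, (log_sq_lt h2 _).1 a2, (lt_log_sq h3 _).1 b1,
    (log_sq_lt h3 _).1 b2⟩

lemma cauchyExt_diff {μ a : ℝ} (ha : a ∈ Set.Ioo (-μ / 2) (μ / 2 - 2 * Real.pi))
    {g : ℂ × ℂ × ℂ → ℂ} (hg : DifferentiableOn ℂ g (wormTrunc μ)) :
    DifferentiableOn ℂ (cauchyExt g (rin a) (rout a)) (wormPiece a) := by
  intro z hz
  obtain ⟨i1, i2, i3, i4⟩ := piece_norms hz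
  have hr := (rin_pos a).le
  have hR := hr.trans (rin_lt_rout a).le
  have T : ∀ ρ σ, (ρ = rin a ∨ ρ = rout a) → (σ = rin a ∨ σ = rout a) →
      DifferentiableAt ℂ (torusInt g ρ σ) z := by
    intro ρ σ hρ hσ
    apply torusInt_diff (isOpen_wormTrunc μ) hg
    · rcases hρ with rfl | rfl <;> assumption
    · rcases hσ with rfl | rfl <;> assumption
    · intro ζ hζ ξ hξ
      rw [mem_sphere_zero_iff_norm] at hζ hξ
      exact corner_mem ha hz.1 (by rwa [hζ]) (by rwa [hξ])
    · rcases hρ with rfl | rfl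
      exacts [i1.ne', i2.ne]
    · rcases hσ with rfl | rfl
      exacts [i3.ne', i4.ne]
  apply DifferentiableAt.differentiableWithinAt
  exact ((((T _ _ (Or.inr rfl) (Or.inr rfl)).sub (T _ _ (Or.inr rfl) (Or.inl rfl))).sub
    (T _ _ (Or.inl rfl) (Or.inr rfl))).add (T _ _ (Or.inl rfl) (Or.inl rfl))).const_mul _

lemma cauchyExt_tendsto {μ a : ℝ} (ha : a ∈ Set.Ioo (-μ / 2) (μ / 2 - 2 * Real.pi))
    {g : ℂ × ℂ × ℂ → ℂ} {gs : ℕ → ℂ × ℂ × ℂ → ℂ}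
    (hg : DifferentiableOn ℂ g (wormTrunc μ)) (hgs : ∀ n, DifferentiableOn ℂ (gs n) (wormTrunc μ))
    (hu : ∀ K ⊆ wormTrunc μ, IsCompact K → ∀ ε > 0, ∀ᶠ n in Filter.atTop,
      ∀ p ∈ K, ‖gs n p - g p‖ ≤ ε)
    {z : ℂ × ℂ × ℂ} (hz : z ∈ wormPiece a) :
    Filter.Tendsto (fun n => cauchyExt (gs n) (rin a) (rout a) z) Filter.atTop
      (nhds (cauchyExt g (rin a) (rout a) z)) := by
  obtain ⟨i1, i2, i3, i4⟩ := piece_norms hz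
  have hr := (rin_pos a).le
  have hR := hr.trans (rin_lt_rout a).le
  have T : ∀ ρ σ, (ρ = rin a ∨ ρ = rout a) → (σ = rin a ∨ σ = rout a) →
      Filter.Tendsto (fun n => torusInt (gs n) ρ σ z) Filter.atTop
        (nhds (torusInt g ρ σ z)) := by
    intro ρ σ hρ hσ
    apply torusInt_tendsto (isOpen_wormTrunc μ) hg hgs hu
    · rcases hρ with rfl | rfl <;> assumption
    · rcases hσ with rfl | rfl <;> assumption
    · intro ζ hζ ξ hξ
      rw [mem_sphere_zero_iff_norm] at hζ hξ
      exact corner_mem ha hz.1 (by rwa [hζ]) (by rwa [hξ])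
    · rcases hρ with rfl | rfl
      exacts [i1.ne', i2.ne]
    · rcases hσ with rfl | rfl
      exacts [i3.ne', i4.ne]
  exact ((((T _ _ (Or.inr rfl) (Or.inr rfl)).sub (T _ _ (Or.inr rfl) (Or.inl rfl))).sub
    (T _ _ (Or.inl rfl) (Or.inr rfl))).add (T _ _ (Or.inl rfl) (Or.inl rfl))).const_mul _

lemma cauchyExt_near_zero {μ a : ℝ} (ha : a ∈ Set.Ioo (-μ / 2) (μ / 2 - 2 * Real.pi))
    {g : ℂ × ℂ × ℂ → ℂ} {Y : Set (ℂ × ℂ × ℂ)} (hY : IsOpen Y)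
    (hYc : closure (wormTrunc μ) ⊆ Y) (hg : DifferentiableOn ℂ g Y) :
    ∃ δ > 0, ∀ z ∈ wormPiece a, ‖z.1‖ < δ → cauchyExt g (rin a) (rout a) z = g z := by
  have hπ := Real.pi_pos
  set A : Set ℂ := Metric.closedBall 0 (rout a) \ Metric.ball 0 (rin a) with hA
  have hAc : IsCompact A := (isCompact_closedBall _ _).diff Metric.isOpen_ball
  have hAm : ∀ w ∈ A, w ≠ 0 ∧ -μ < Real.log (‖w‖ ^ 2) ∧ Real.log (‖w‖ ^ 2) < μ := by
    rintro w ⟨h1, h2⟩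
    rw [mem_closedBall_zero_iff] at h1
    rw [mem_ball_zero_iff, not_lt] at h2
    have hw : w ≠ 0 := norm_pos_iff.1 ((rin_pos a).trans_le h2)
    have u1 : ¬ (Real.log (‖w‖ ^ 2) < a) := by rw [log_sq_lt hw]; exact not_lt.2 h2
    have u2 : ¬ (a + 2 * Real.pi < Real.log (‖w‖ ^ 2)) := by rw [lt_log_sq hw]; exact not_lt.2 h1
    refine ⟨hw, ?_, ?_⟩ <;> linarith [ha.1, ha.2]
  obtain ⟨u, v, hu, hv, h0u, hAv, huv⟩ := generalized_tube_lemma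
    (isCompact_singleton (x := (0:ℂ))) (hAc.prod hAc) hY (by
      rintro ⟨x, ζ, ξ⟩ ⟨hx, hζ, hξ⟩
      simp only [Set.mem_singleton_iff] at hx
      subst hx
      obtain ⟨n2, a1, a2⟩ := hAm ζ hζ
      obtain ⟨n3, b1, b2⟩ := hAm ξ hξ
      exact hYc (zero_mem_closure n2 n3 a1 a2 b1 b2))
  obtain ⟨δ, hδ, hδu⟩ := Metric.isOpen_iff.1 hu 0 (h0u rfl)
  refine ⟨δ, hδ, fun z hz hzδ => ?_⟩
  obtain ⟨i1, i2, i3, i4⟩ := piece_norms hz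
  apply cauchyExt_eq hY hg (rin_pos a) (rin_lt_rout a) _ i1 i2 i3 i4
  intro ζ ξ k1 k2 k3 k4
  refine huv ⟨hδu (by simpa using hzδ), hAv ⟨⟨?_, ?_⟩, ⟨?_, ?_⟩⟩⟩ <;> simpa

lemma slice_diff {a : ℝ} {G : ℂ × ℂ × ℂ → ℂ} (hG : DifferentiableOn ℂ G (wormPiece a))
    {z : ℂ × ℂ × ℂ} (hz : z ∈ wormPiece a) :
    DifferentiableOn ℂ (fun w => G (w, z.2.1, z.2.2))
      (Metric.ball (Complex.exp (2 * Complex.I * (a : ℂ))) 1) := by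
  apply hG.comp (by fun_prop)
  intro w hw
  rw [Metric.mem_ball, dist_eq_norm] at hw
  exact ⟨hw, hz.2⟩

lemma cauchyExt_eq_self {μ a : ℝ} (ha : a ∈ Set.Ioo (-μ / 2) (μ / 2 - 2 * Real.pi))
    {g : ℂ × ℂ × ℂ → ℂ} {Y : Set (ℂ × ℂ × ℂ)} (hY : IsOpen Y)
    (hYc : closure (wormTrunc μ) ⊆ Y) (hg : DifferentiableOn ℂ g Y) {z : ℂ × ℂ × ℂ}
    (hz : z ∈ wormPiece a) (hzW : z ∈ wormTrunc μ) :
    cauchyExt g (rin a) (rout a) z = g z := by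
  have hgW : DifferentiableOn ℂ g (wormTrunc μ) := hg.mono (subset_closure.trans hYc)
  obtain ⟨δ, hδ, h⟩ := cauchyExt_near_zero ha hY hYc hg
  refine eq_on_lens (c := Complex.exp (2 * Complex.I * (a : ℂ)))
    (c' := Complex.exp (Complex.I * (Lofz z : ℂ)))
    (k1 := fun w => cauchyExt g (rin a) (rout a) (w, z.2.1, z.2.2))
    (k2 := fun w => g (w, z.2.1, z.2.2)) (norm_exp_two_I_mul a)
    (norm_exp_I_mul _) (slice_diff (cauchyExt_diff ha hgW) hz) ?_ hδ ?_ (w := z.1) ?_ ?_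
  · apply hgW.comp (by fun_prop)
    intro w hw
    rw [Metric.mem_ball, dist_eq_norm] at hw
    exact ⟨hzW.1, hzW.2.1, hw, hzW.2.2.2⟩
  · intro w hw _ hwδ
    rw [Metric.mem_ball, dist_eq_norm] at hw
    exact h (w, z.2.1, z.2.2) ⟨hw, hz.2⟩ hwδ
  · rw [Metric.mem_ball, dist_eq_norm]; exact hz.1
  · rw [Metric.mem_ball, dist_eq_norm]; exact hzW.2.2.1

lemma cauchyExt_compat {μ a b : ℝ} (ha : a ∈ Set.Ioo (-μ / 2) (μ / 2 - 2 * Real.pi))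
    (hb : b ∈ Set.Ioo (-μ / 2) (μ / 2 - 2 * Real.pi))
    {g : ℂ × ℂ × ℂ → ℂ} {Y : Set (ℂ × ℂ × ℂ)} (hY : IsOpen Y)
    (hYc : closure (wormTrunc μ) ⊆ Y) (hg : DifferentiableOn ℂ g Y) {z : ℂ × ℂ × ℂ}
    (hz : z ∈ wormPiece a) (hzb : z ∈ wormPiece b) :
    cauchyExt g (rin a) (rout a) z = cauchyExt g (rin b) (rout b) z := by
  have hgW : DifferentiableOn ℂ g (wormTrunc μ) := hg.mono (subset_closure.trans hYc)
  obtain ⟨δ, hδ, h⟩ := cauchyExt_near_zero ha hY hYc hg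
  obtain ⟨δ', hδ', h'⟩ := cauchyExt_near_zero hb hY hYc hg
  refine eq_on_lens (c := Complex.exp (2 * Complex.I * (a : ℂ)))
    (c' := Complex.exp (2 * Complex.I * (b : ℂ)))
    (k1 := fun w => cauchyExt g (rin a) (rout a) (w, z.2.1, z.2.2))
    (k2 := fun w => cauchyExt g (rin b) (rout b) (w, z.2.1, z.2.2)) (norm_exp_two_I_mul a)
    (norm_exp_two_I_mul b) (slice_diff (cauchyExt_diff ha hgW) hz)
    (slice_diff (cauchyExt_diff hb hgW) hzb) (lt_min hδ hδ') ?_ (w := z.1) ?_ ?_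
  · intro w hw hw' hwδ
    rw [Metric.mem_ball, dist_eq_norm] at hw hw'
    have e1 := h (w, z.2.1, z.2.2) ⟨hw, hz.2⟩ (hwδ.trans_le (min_le_left _ _))
    have e2 := h' (w, z.2.1, z.2.2) ⟨hw', hzb.2⟩ (hwδ.trans_le (min_le_right _ _))
    exact e1.trans e2.symm
  · rw [Metric.mem_ball, dist_eq_norm]; exact hz.1
  · rw [Metric.mem_ball, dist_eq_norm]; exact hzb.1

open MeasureTheory in
lemma unif_of_L2 {W : Set (ℂ × ℂ × ℂ)} (hW : IsOpen W) {g : ℂ × ℂ × ℂ → ℂ}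
    {gs : ℕ → ℂ × ℂ × ℂ → ℂ}
    (hg : DifferentiableOn ℂ g W) (hgs : ∀ n, DifferentiableOn ℂ (gs n) W)
    (hint : ∀ n, IntegrableOn (fun z => ‖gs n z - g z‖ ^ 2) W)
    (hconv : Filter.Tendsto
      (fun n => ∫ z in W, ‖gs n z - g z‖ ^ 2) Filter.atTop (nhds 0)) :
    ∀ K ⊆ W, IsCompact K → ∀ ε > 0, ∀ᶠ n in Filter.atTop, ∀ p ∈ K, ‖gs n p - g p‖ ≤ ε := by
  intro K hKW hK ε hε
  obtain ⟨r, hr, hrW⟩ := hK.exists_cthickening_subset_open hW hKW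
  have hpi := Real.pi_pos
  set C : ℝ := ((Real.pi * r ^ 2) ^ 3)⁻¹ * (2 * ε)⁻¹ with hC
  have ht : Filter.Tendsto (fun n => ε / 2 + C * ∫ z in W, ‖gs n z - g z‖ ^ 2) Filter.atTop
      (nhds (ε / 2)) := by
    simpa using (hconv.const_mul C).const_add (ε / 2)
  filter_upwards [ht.eventually_lt_const (show ε / 2 < ε by linarith)] with n hn p hp
  have := norm_le_of_L2 (h := fun z => gs n z - g z) hr hW
    ((Metric.closedBall_subset_cthickening hp r).trans hrW) ((hgs n).sub hg) (hint n) hε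
  exact this.trans hn.le

open MeasureTheory in
/-- If `f_n → f` in `L²(W'_μ)`, where each `f_n` is holomorphic on an open
neighborhood of the closure of `W'_μ` and `f` is holomorphic and square-integrable
on `W'_μ`, then `f` extends holomorphically to `Ŵ'_μ` (for `μ > 4π`). -/
theorem extension_of_L2_limit (μ : ℝ) (hμ : 4 * Real.pi < μ)
    (fs : ℕ → ℂ × ℂ × ℂ → ℂ)
    (hfs : ∀ n : ℕ, ∃ Y : Set (ℂ × ℂ × ℂ), IsOpen Y ∧ closure (wormTrunc μ) ⊆ Y ∧
      DifferentiableOn ℂ (fs n) Y)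
    (f : ℂ × ℂ × ℂ → ℂ) (hf : DifferentiableOn ℂ f (wormTrunc μ))
    (hfL2 : IntegrableOn (fun z => ‖f z‖ ^ 2) (wormTrunc μ) volume)
    (hconv : Filter.Tendsto
      (fun n => ∫ z in wormTrunc μ, ‖fs n z - f z‖ ^ 2) Filter.atTop (nhds 0)) :
    ∃ F : ℂ × ℂ × ℂ → ℂ, DifferentiableOn ℂ F (wormHat μ) ∧
      Set.EqOn F f (wormTrunc μ) := by
  have hWo := isOpen_wormTrunc μ
  choose Y hYo hYc hYd using hfs
  have hfsW : ∀ n, DifferentiableOn ℂ (fs n) (wormTrunc μ) := fun n =>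
    (hYd n).mono (subset_closure.trans (hYc n))
  have hint : ∀ n, IntegrableOn (fun z => ‖fs n z - f z‖ ^ 2) (wormTrunc μ) := by
    intro n
    have h1 : IntegrableOn (fun z => ‖fs n z‖ ^ 2) (wormTrunc μ) := by
      have hc : ContinuousOn (fun z => ‖fs n z‖ ^ 2) (closure (wormTrunc μ)) :=
        ((hYd n).continuousOn.mono (hYc n)).norm.pow 2
      exact (hc.integrableOn_compact (isCompact_closure_wormTrunc μ)).mono_set subset_closure
    refine Integrable.mono' ((h1.const_mul 2).add (hfL2.const_mul 2)) ?_ ?_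
    · exact ContinuousOn.aestronglyMeasurable
        (((hfsW n).sub hf).continuousOn.norm.pow 2) hWo.measurableSet
    · refine Filter.Eventually.of_forall fun z => ?_
      change ‖‖fs n z - f z‖ ^ 2‖ ≤ 2 * ‖fs n z‖ ^ 2 + 2 * ‖f z‖ ^ 2
      rw [Real.norm_of_nonneg (by positivity)]
      have := norm_sub_le (fs n z) (f z)
      have h0 := norm_nonneg (fs n z - f z)
      nlinarith [sq_nonneg (‖fs n z‖ - ‖f z‖)]
  have hu := unif_of_L2 hWo hf hfsW hint hconv
  have hpt : ∀ z ∈ wormTrunc μ, Filter.Tendsto (fun n => fs n z) Filter.atTop (nhds (f z)) := by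
    intro z hz
    rw [Metric.tendsto_nhds]
    intro ε hε
    filter_upwards [hu {z} (by simpa using hz) isCompact_singleton (ε / 2) (by positivity)]
      with n hn
    have := hn z rfl
    rw [dist_eq_norm]
    linarith
  have hself : ∀ a ∈ Set.Ioo (-μ / 2) (μ / 2 - 2 * Real.pi), ∀ z ∈ wormPiece a,
      z ∈ wormTrunc μ → cauchyExt f (rin a) (rout a) z = f z := by
    intro a ha z hz hzW
    have t := cauchyExt_tendsto ha hf hfsW hu hz
    refine tendsto_nhds_unique t ((hpt z hzW).congr fun n => ?_)
    exact (cauchyExt_eq_self ha (hYo n) (hYc n) (hYd n) hz hzW).symm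
  have hcompat : ∀ a ∈ Set.Ioo (-μ / 2) (μ / 2 - 2 * Real.pi),
      ∀ b ∈ Set.Ioo (-μ / 2) (μ / 2 - 2 * Real.pi), ∀ z ∈ wormPiece a, z ∈ wormPiece b →
      cauchyExt f (rin a) (rout a) z = cauchyExt f (rin b) (rout b) z := by
    intro a ha b hb z hz hzb
    have t := cauchyExt_tendsto ha hf hfsW hu hz
    have t' := cauchyExt_tendsto hb hf hfsW hu hzb
    refine tendsto_nhds_unique t (t'.congr fun n => ?_)
    exact (cauchyExt_compat ha hb (hYo n) (hYc n) (hYd n) hz hzb).symm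
  classical
  set P : ℂ × ℂ × ℂ → Prop := fun z =>
    ∃ a, a ∈ Set.Ioo (-μ / 2) (μ / 2 - 2 * Real.pi) ∧ z ∈ wormPiece a with hP
  set F : ℂ × ℂ × ℂ → ℂ := fun z =>
    if h : P z then cauchyExt f (rin h.choose) (rout h.choose) z else f z with hF
  have hFp : ∀ a ∈ Set.Ioo (-μ / 2) (μ / 2 - 2 * Real.pi),
      Set.EqOn F (cauchyExt f (rin a) (rout a)) (wormPiece a) := by
    intro a ha z hz
    have h : P z := ⟨a, ha, hz⟩
    simp only [hF, dif_pos h]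
    exact hcompat _ h.choose_spec.1 a ha z h.choose_spec.2 hz
  have hFf : Set.EqOn F f (wormTrunc μ) := by
    intro z hz
    by_cases h : P z
    · simp only [hF, dif_pos h]
      exact hself _ h.choose_spec.1 z h.choose_spec.2 hz
    · simp only [hF, dif_neg h]
  refine ⟨F, ?_, hFf⟩
  rintro z (hz | hz)
  · apply DifferentiableAt.differentiableWithinAt
    exact (hf.differentiableAt (hWo.mem_nhds hz)).congr_of_eventuallyEq
      (hFf.eventuallyEq_of_mem (hWo.mem_nhds hz))
  · simp only [Set.mem_iUnion] at hz
    obtain ⟨a, ha, hz⟩ := hz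
    have hza : z ∈ wormPiece a := hz
    have hn := (isOpen_wormPiece a).mem_nhds hza
    apply DifferentiableAt.differentiableWithinAt
    exact ((cauchyExt_diff ha hf).differentiableAt hn).congr_of_eventuallyEq
      ((hFp a ha).eventuallyEq_of_mem hn)
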